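/- arXiv:1806.03113 — 2 statements merged into one kernel-verified Lean document; each statement's English description precedes it below -/
import Mathlib

section
/- For a real number d > 0, the symmetric 4×4 real matrix Q₁(d) = [[1, 0, −1/2, −d/2], [0, d, d/2, −d/2], [−1/2, d/2, 1, 0], [−d/2, −d/2, 0, d]] is positive definite if and only if d < 3. In particular, among positive integers, Q₁(d) is positive definite exactly for d ∈ {1, 2}. -/
/-- The symmetric matrix of the quadratic form
`Q₁(x,y,z,w) = x² + d·y² + z² + d·w² − (xz + d·yw) − d·(xw − yz)` arising in the
analysis of the algebraic Gauss algorithm over Type I rings `ℤ[√−d]`. -/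
noncomputable def Q1 (d : ℝ) : Matrix (Fin 4) (Fin 4) ℝ :=
  !![1, 0, -1/2, -d/2;
     0, d, d/2, -d/2;
     -1/2, d/2, 1, 0;
     -d/2, -d/2, 0, d]

/-- Completing the squares in the quadratic form of `Q1 d`. -/
theorem Q1_dotProduct_mulVec (d : ℝ) (v : Fin 4 → ℝ) :
    star v ⬝ᵥ (Q1 d).mulVec v =
      (v 0 - v 2 / 2 - d * v 3 / 2) ^ 2 + d * (v 1 + v 2 / 2 - v 3 / 2) ^ 2 +
        (3 - d) / 4 * (v 2 ^ 2 + d * v 3 ^ 2) := by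
  simp [Q1, dotProduct, Matrix.mulVec, Fin.sum_univ_four]
  ring

theorem Q1_isHermitian (d : ℝ) : (Q1 d).IsHermitian := by
  ext i j
  fin_cases i <;> fin_cases j <;> simp [Q1]

theorem Q1_posDef_iff {d : ℝ} (hd : 0 < d) : (Q1 d).PosDef ↔ d < 3 := by
  constructor
  · intro h
    have hne : (![1, -1, 2, 0] : Fin 4 → ℝ) ≠ 0 := fun h0 => by
      simpa using congrFun h0 0
    have hpos := h.dotProduct_mulVec_pos hne
    rw [Q1_dotProduct_mulVec] at hpos
    have e2 : (![1, -1, 2, 0] : Fin 4 → ℝ) 2 = 2 := rfl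
    have e3 : (![1, -1, 2, 0] : Fin 4 → ℝ) 3 = 0 := rfl
    norm_num [e2, e3] at hpos
    linarith
  · intro h
    refine Matrix.PosDef.of_dotProduct_mulVec_pos (Q1_isHermitian d) fun v hv => ?_
    rw [Q1_dotProduct_mulVec]
    have hc : 0 < (3 - d) / 4 := by linarith
    by_cases h2 : v 2 = 0
    · by_cases h3 : v 3 = 0
      · by_cases h0 : v 0 = 0
        · have h1 : v 1 ≠ 0 := fun h1 => hv <| by
            ext i
            fin_cases i <;> simp [h0, h1, h2, h3]
          simp only [h0, h2, h3]
          ring_nf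
          positivity
        · simp only [h2, h3]
          ring_nf
          positivity
      · positivity
    · positivity

/-- for real `d > 0`, `Q₁(d)` is positive definite iff `d < 3`;
in particular, among positive integers, `Q₁(d)` is positive definite exactly
for `d ∈ {1, 2}`. -/
theorem stmt_9 :
    (∀ d : ℝ, 0 < d → ((Q1 d).PosDef ↔ d < 3)) ∧
    (∀ m : ℕ, 0 < m → ((Q1 m).PosDef ↔ m = 1 ∨ m = 2)) := by
  refine ⟨fun d hd => Q1_posDef_iff hd, fun m hm => ?_⟩
  rw [Q1_posDef_iff (by exact_mod_cast hm)]
  have hlt : (m : ℝ) < 3 ↔ m < 3 := by exact_mod_cast Iff.rfl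
  rw [hlt]
  omega
end

section
/- For each d ∈ {3, 7, 11}, writing D = (1+d)/4, the symmetric 4×4 real matrix Q₂(d) = [[1, 1/2, −1/2, −D/2], [1/2, D, (D−1)/2, −D/2], [−1/2, (D−1)/2, 1, 1/2], [−D/2, −D/2, 1/2, D]] is positive definite. -/
/-- The symmetric matrix of the quadratic form `Q₂` (with `D = (1+d)/4`)
arising in the analysis of the algebraic Gauss algorithm over Type II rings
`ℤ[(1+√−d)/2]`. -/
noncomputable def Q2 (D : ℝ) : Matrix (Fin 4) (Fin 4) ℝ :=
  !![1, 1/2, -1/2, -D/2;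
     1/2, D, (D-1)/2, -D/2;
     -1/2, (D-1)/2, 1, 1/2;
     -D/2, -D/2, 1/2, D]

theorem Q2_isHermitian (D : ℝ) : (Q2 D).IsHermitian := by
  ext i j
  fin_cases i <;> fin_cases j <;> simp [Q2]

theorem dotProduct_Q2_mulVec (D : ℝ) (v : Fin 4 → ℝ) :
    v ⬝ᵥ (Q2 D).mulVec v =
      (v 0 + v 1 / 2 - v 2 / 2 - D / 2 * v 3) ^ 2
        + 3 / 4 * (v 2 + (2 * D - 1) / 3 * v 1 + (2 - D) / 3 * v 3) ^ 2
        + (4 * D - D ^ 2 - 1) / 3 * ((v 1 - v 3 / 2) ^ 2 + 3 / 4 * v 3 ^ 2) := by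
  simp [Q2, dotProduct, Matrix.mulVec, Fin.sum_univ_four]
  ring

theorem Q2_posDef {D : ℝ} (hD : 0 < 4 * D - D ^ 2 - 1) : (Q2 D).PosDef := by
  refine .of_dotProduct_mulVec_pos (Q2_isHermitian D) fun v hv => ?_
  rw [star_trivial, dotProduct_Q2_mulVec]
  by_cases h3 : v 3 = 0
  · by_cases h1 : v 1 = 0
    · by_cases h2 : v 2 = 0
      · have h0 : v 0 ≠ 0 := fun h0 => hv (by ext i; fin_cases i <;> assumption)
        simp only [h1, h2, h3]
        ring_nf
        positivity
      · simp only [h1, h3, mul_zero, add_zero]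
        positivity
    · simp only [h3, zero_div, sub_zero]
      positivity
  · positivity

/-- for `d ∈ {3, 7, 11}` and `D = (1+d)/4`, the matrix `Q₂(d)`
is positive definite. -/
theorem stmt_10 (d : ℕ) (hd : d = 3 ∨ d = 7 ∨ d = 11) :
    (Q2 ((1 + d) / 4)).PosDef := by
  apply Q2_posDef
  rcases hd with rfl | rfl | rfl <;> norm_num
end
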